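/- Let U_P be a pattern group, u ∈ U_P and λ ∈ 𝔫_P*, and let T_1,…,T_l be the connected components of G_λ. Then χ^λ(u) = ∏_{i=1}^{l} χ^{λ[T_i]}(u). -/

import Mathlib

open Matrix BigOperators
open scoped Classical

/-- `n × n` matrices over `F`. -/
abbrev Mat (n : ℕ) (F : Type*) := Matrix (Fin n) (Fin n) F

section Defs

variable {n : ℕ} {F : Type*} [Field F] [Fintype F]

/-- The pattern group `U_P` attached to a relation `P` on `{0,…,n-1}`:
unipotent upper-triangular matrices supported (off the diagonal) on positions `(i,j)` with `P i j`. -/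
def patGroup (P : Fin n → Fin n → Prop) : Set (Mat n F) :=
  {u | (∀ i, u i i = 1) ∧ ∀ i j, i ≠ j → ¬ P i j → u i j = 0}

/-- Truncation of a matrix to the positions allowed by `P` (used to identify a functional on
`𝔫_P` with the matrix of its coefficients on allowable positions). -/
noncomputable def truncP (P : Fin n → Fin n → Prop) (A : Mat n F) : Mat n F :=
  Matrix.of fun i j => if P i j then A i j else 0

/-- The left orbit `U_P λ` of the functional (identified with a matrix) `lam`:
`(aλ)(x) = λ(a⁻¹ x)`, whose coefficient matrix is the truncation of `(a⁻¹)ᵀ * λ`. -/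
noncomputable def dualLeftOrbit (P : Fin n → Fin n → Prop) (lam : Mat n F) : Set (Mat n F) :=
  {mu | ∃ a ∈ (patGroup P : Set (Mat n F)), mu = truncP P ((a⁻¹)ᵀ * lam)}

/-- The two-sided orbit `U_P λ U_P` of the functional `lam`: `(aλb)(x) = λ(a⁻¹ x b⁻¹)`,
whose coefficient matrix is the truncation of `(a⁻¹)ᵀ * λ * (b⁻¹)ᵀ`. -/
noncomputable def dualOrbit (P : Fin n → Fin n → Prop) (lam : Mat n F) : Set (Mat n F) :=
  {mu | ∃ a ∈ (patGroup P : Set (Mat n F)), ∃ b ∈ (patGroup P : Set (Mat n F)),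
    mu = truncP P ((a⁻¹)ᵀ * lam * (b⁻¹)ᵀ)}

/-- The two-sided superclass orbit `{a (v-1) b : a, b ∈ U_P}` attached to `v ∈ U_P`. -/
def classOrbit (P : Fin n → Fin n → Prop) (v : Mat n F) : Set (Mat n F) :=
  {x | ∃ a ∈ (patGroup P : Set (Mat n F)), ∃ b ∈ (patGroup P : Set (Mat n F)),
    x = a * (v - 1) * b}

/-- The pairing `λ(x) = Σ_{i,j} λ_{ij} x_{ij}` of a functional-matrix with a matrix. -/
def pairM (A B : Mat n F) : F := ∑ i, ∑ j, A i j * B i j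

/-- The supercharacter `χ^λ` of the pattern group `U_P` attached to the functional `lam`:
`χ^λ(u) = (|U_Pλ|/|U_PλU_P|) Σ_{μ ∈ U_PλU_P} θ(−μ(u−1))`. -/
noncomputable def superChar (P : Fin n → Fin n → Prop) (θ : AddChar F ℂ)
    (lam u : Mat n F) : ℂ :=
  ((dualLeftOrbit P lam).ncard : ℂ) / ((dualOrbit P lam).ncard : ℂ) *
    ∑ᶠ mu ∈ dualOrbit P lam, θ (- pairM mu (u - 1))

/-- The full order `i < j`, whose pattern group is `U_n`. -/
def Plt (n : ℕ) : Fin n → Fin n → Prop := fun i j => i < j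

/-- The poset `𝒫_(m)` (in 0-based indexing): `i < j`, except that row `0` (row `1` in 1-based
indexing) is only comparable to columns `j` with 1-based value `j+1 > m`.  Its pattern group is
the interpolating group `U_(m)`. -/
def Pm (n m : ℕ) : Fin n → Fin n → Prop := fun i j => i < j ∧ (i.val = 0 → m < j.val + 1)

/-- `𝒮_n(q)`: strictly upper-triangular matrices with at most one nonzero entry in each row
and each column. -/
def Sset (n : ℕ) (F : Type*) [Field F] : Set (Mat n F) :=
  {lam | (∀ i j : Fin n, ¬ i < j → lam i j = 0) ∧
    (∀ (i j j' : Fin n), lam i j ≠ 0 → lam i j' ≠ 0 → j = j') ∧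
    (∀ (i i' j : Fin n), lam i j ≠ 0 → lam i' j ≠ 0 → i = i')}

/-- Adjacency of two nonzero positions of `A` (they share a row or a column): the edges of
the graph `G_A`. -/
def adjRel (A : Mat n F) (p q : Fin n × Fin n) : Prop :=
  p ≠ q ∧ A p.1 p.2 ≠ 0 ∧ A q.1 q.2 ≠ 0 ∧ (p.1 = q.1 ∨ p.2 = q.2)

/-- The connected component of the position `p` in the graph `G_A`. -/
def compOf (A : Mat n F) (p : Fin n × Fin n) : Set (Fin n × Fin n) :=
  {q | Relation.ReflTransGen (adjRel A) p q}

/-- The set of connected components of the graph `G_A`. -/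
def comps (A : Mat n F) : Set (Set (Fin n × Fin n)) :=
  {S | ∃ p : Fin n × Fin n, A p.1 p.2 ≠ 0 ∧ S = compOf A p}

/-- The matrix agreeing with `A` on the positions of `S` and vanishing elsewhere. -/
noncomputable def restrictTo (S : Set (Fin n × Fin n)) (A : Mat n F) : Mat n F :=
  Matrix.of fun i j => if (i, j) ∈ S then A i j else 0

/-- At most one connected component of `G_A` has more than one vertex. -/
def AtMostOneBig (A : Mat n F) : Prop :=
  ∀ p q : Fin n × Fin n, A p.1 p.2 ≠ 0 → A q.1 q.2 ≠ 0 →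
    1 < (compOf A p).ncard → 1 < (compOf A q).ncard → compOf A p = compOf A q

end Defs

section Averaging

/-- If the fibres of `f` on a finite group are permuted by left translation, then averaging over
the group is the same as averaging over the image. -/
theorem card_mul_finsum_range {G X : Type*} [Group G] [Fintype G] (f : G → X)
    (hf : ∀ k g h : G, f g = f h → f (k * g) = f (k * h)) (φ : X → ℂ) :
    (Fintype.card G : ℂ) * ∑ᶠ x ∈ Set.range f, φ x = (Set.range f).ncard * ∑ g, φ (f g) := by
  have hcard : ∀ g : G, (Finset.univ.filter fun h => f h = f g).card =
      (Finset.univ.filter fun h => f h = f 1).card := by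
    intro g
    refine Finset.card_bij' (fun h _ => g⁻¹ * h) (fun h _ => g * h) ?_ ?_ ?_ ?_
    · intro h hh
      simpa using hf g⁻¹ h g (by simpa using hh)
    · intro h hh
      simpa using hf g h 1 (by simpa using hh)
    · simp
    · simp
  set N := (Finset.univ.filter fun h => f h = f 1).card
  have hfib : ∀ x ∈ Finset.univ.image f, (Finset.univ.filter fun h => f h = x).card = N := by
    intro x hx
    obtain ⟨g, -, rfl⟩ := Finset.mem_image.1 hx
    exact hcard g
  have hrange : Set.range f = ↑(Finset.univ.image f) := by simp
  have hG : Fintype.card G = (Finset.univ.image f).card * N := by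
    rw [← Finset.card_univ, Finset.card_eq_sum_card_image f, Finset.sum_congr rfl hfib]
    simp
  have hsum : ∑ g, φ (f g) = N * ∑ x ∈ Finset.univ.image f, φ x := by
    rw [Finset.sum_comp, Finset.mul_sum]
    refine Finset.sum_congr rfl fun x hx => ?_
    rw [hfib x hx, nsmul_eq_mul]
  rw [hrange, finsum_mem_coe_finset, Set.ncard_coe_finset, hsum, hG]
  push_cast
  ring

/-- Expectations of finitely many independent functions multiply. Independence of `g k` from the
other functions is expressed by a permutation of `Ω × Ω` which exchanges coordinates. -/
theorem expect_prod_eq_prod_expect {Ω κ : Type*} [Fintype Ω] [Nonempty Ω] [Fintype κ]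
    (g : κ → Ω → ℂ)
    (hg : ∀ k, ∃ σ : Equiv.Perm (Ω × Ω), ∀ w, g k (σ w).1 = g k w.1 ∧
      ∀ i, i ≠ k → g i (σ w).1 = g i w.2) :
    (∑ w, ∏ k, g k w) / Fintype.card Ω = ∏ k, ((∑ w, g k w) / Fintype.card Ω) := by
  have hΩ : (Fintype.card Ω : ℂ) ≠ 0 := by simp
  suffices h : ∀ s : Finset κ, (∑ w, ∏ k ∈ s, g k w) / Fintype.card Ω =
      ∏ k ∈ s, ((∑ w, g k w) / Fintype.card Ω) from h Finset.univ
  intro s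
  induction s using Finset.induction_on with
  | empty => simp [hΩ]
  | insert k s hk ih =>
    rw [Finset.prod_insert hk, ← ih]
    simp only [Finset.prod_insert hk]
    obtain ⟨σ, hσ⟩ := hg k
    have key : (∑ w, g k w) * ∑ w, ∏ i ∈ s, g i w =
        Fintype.card Ω * ∑ w, g k w * ∏ i ∈ s, g i w := by
      calc (∑ w, g k w) * ∑ w, ∏ i ∈ s, g i w
          = ∑ w : Ω × Ω, g k w.1 * ∏ i ∈ s, g i w.2 := by
            rw [Finset.sum_mul_sum, Fintype.sum_prod_type]
        _ = ∑ w : Ω × Ω, g k (σ w).1 * ∏ i ∈ s, g i (σ w).1 := by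
            refine Finset.sum_congr rfl fun w _ => ?_
            rw [(hσ w).1]
            congr 1
            refine Finset.prod_congr rfl fun i hi => ?_
            rw [(hσ w).2 i (by rintro rfl; exact hk hi)]
        _ = ∑ w : Ω × Ω, g k w.1 * ∏ i ∈ s, g i w.1 :=
            Equiv.sum_comp σ fun w => g k w.1 * ∏ i ∈ s, g i w.1
        _ = Fintype.card Ω * ∑ w, g k w * ∏ i ∈ s, g i w := by
            rw [Fintype.sum_prod_type]
            simp [Finset.mul_sum]
    field_simp
    linear_combination -key

end Averaging

section PatternGroup

variable {n : ℕ} {F : Type*} [Field F]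

/-- The pattern group as a type. -/
abbrev PatElt (F : Type*) [Field F] (P : Fin n → Fin n → Prop) : Type _ :=
  {a : Mat n F // a ∈ patGroup P}

theorem one_mem_patGroup (P : Fin n → Fin n → Prop) : (1 : Mat n F) ∈ patGroup P :=
  ⟨fun i => by simp, fun i j hij _ => by simp [hij]⟩

theorem mul_mem_patGroup {P : Fin n → Fin n → Prop} (hP1 : ∀ i j, P i j → i < j)
    (hP2 : ∀ i j k, P i j → P j k → P i k) {a b : Mat n F} (ha : a ∈ patGroup P)
    (hb : b ∈ patGroup P) : a * b ∈ patGroup P := by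
  constructor
  · intro i
    rw [Matrix.mul_apply, Finset.sum_eq_single i, ha.1, hb.1, one_mul]
    · intro k _ hk
      by_cases h : P i k
      · rw [hb.2 k i hk fun h' => lt_asymm (hP1 _ _ h) (hP1 _ _ h'), mul_zero]
      · rw [ha.2 i k hk.symm h, zero_mul]
    · simp
  · intro i j hij hP
    rw [Matrix.mul_apply]
    refine Finset.sum_eq_zero fun k _ => ?_
    by_cases hik : i = k
    · subst hik
      rw [hb.2 i j hij hP, mul_zero]
    by_cases h : P i k
    · by_cases hkj : k = j
      · exact absurd (hkj ▸ h) hP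
      · rw [hb.2 k j hkj fun h' => hP (hP2 _ _ _ h h'), mul_zero]
    · rw [ha.2 i k hik h, zero_mul]

theorem det_of_mem_patGroup {P : Fin n → Fin n → Prop} (hP1 : ∀ i j, P i j → i < j)
    {a : Mat n F} (ha : a ∈ patGroup P) : a.det = 1 := by
  rw [Matrix.det_of_isUpperTriangular]
  · simp [ha.1]
  · intro i j hij
    exact ha.2 i j (ne_of_gt hij) fun h => lt_asymm (hP1 _ _ h) hij

theorem truncP_mul_truncP_mul {P : Fin n → Fin n → Prop}
    (hP2 : ∀ i j k, P i j → P j k → P i k) {a b : Mat n F} (ha : a ∈ patGroup P)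
    (hb : b ∈ patGroup P) (M : Mat n F) :
    truncP P (aᵀ * truncP P M * bᵀ) = truncP P (aᵀ * M * bᵀ) := by
  ext i j
  simp only [truncP, Matrix.of_apply]
  split_ifs with hij
  swap
  · rfl
  simp only [Matrix.mul_apply, Matrix.transpose_apply, Finset.sum_mul, Matrix.of_apply]
  refine Finset.sum_congr rfl fun l _ => Finset.sum_congr rfl fun k _ => ?_
  split_ifs with hkl
  · rfl
  by_cases h : (k = i ∨ P k i) ∧ (j = l ∨ P j l)
  · exfalso
    obtain ⟨rfl | hk, rfl | hl⟩ := h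
    · exact hkl hij
    · exact hkl (hP2 _ _ _ hij hl)
    · exact hkl (hP2 _ _ _ hk hij)
    · exact hkl (hP2 _ _ _ hk (hP2 _ _ _ hij hl))
  · rw [not_and_or, not_or, not_or] at h
    rcases h with h | h
    · simp [ha.2 _ _ h.1 h.2]
    · simp [hb.2 _ _ h.1 h.2]

theorem truncP_mul_truncP {P : Fin n → Fin n → Prop}
    (hP2 : ∀ i j k, P i j → P j k → P i k) {a : Mat n F} (ha : a ∈ patGroup P) (M : Mat n F) :
    truncP P (aᵀ * truncP P M) = truncP P (aᵀ * M) := by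
  simpa using truncP_mul_truncP_mul hP2 ha (one_mem_patGroup P) M

theorem pairM_eq_trace (A B : Mat n F) : pairM A B = (Aᵀ * B).trace := by
  simp only [pairM, Matrix.trace, Matrix.diag_apply, Matrix.mul_apply, Matrix.transpose_apply]
  exact Finset.sum_comm

theorem pairM_truncP {P : Fin n → Fin n → Prop} {x : Mat n F} (hx : ∀ i j, ¬ P i j → x i j = 0)
    (a b M : Mat n F) : pairM (truncP P (aᵀ * M * bᵀ)) x = pairM M (a * x * b) := by
  have h : pairM (truncP P (aᵀ * M * bᵀ)) x = pairM (aᵀ * M * bᵀ) x := by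
    refine Finset.sum_congr rfl fun i _ => Finset.sum_congr rfl fun j _ => ?_
    by_cases hij : P i j <;> simp [truncP, hij, hx]
  rw [h, pairM_eq_trace, pairM_eq_trace]
  simp only [Matrix.transpose_mul, Matrix.transpose_transpose, Matrix.mul_assoc]
  rw [Matrix.trace_mul_comm]
  simp only [Matrix.mul_assoc]

theorem truncP_eq_self {P : Fin n → Fin n → Prop} {lam : Mat n F}
    (hlam : ∀ i j, ¬ P i j → lam i j = 0) : truncP P lam = lam := by
  ext i j
  by_cases h : P i j <;> simp [truncP, h, hlam]

theorem inv_inv_of_mem_patGroup {P : Fin n → Fin n → Prop} (hP1 : ∀ i j, P i j → i < j)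
    {a : Mat n F} (ha : a ∈ patGroup P) : a⁻¹⁻¹ = a :=
  Matrix.nonsing_inv_nonsing_inv a (by simp [det_of_mem_patGroup hP1 ha])

variable [Fintype F]

theorem inv_mem_patGroup {P : Fin n → Fin n → Prop} (hP1 : ∀ i j, P i j → i < j)
    (hP2 : ∀ i j k, P i j → P j k → P i k) {a : Mat n F} (ha : a ∈ patGroup P) :
    a⁻¹ ∈ patGroup P := by
  have hdet : IsUnit a.det := by simp [det_of_mem_patGroup hP1 ha]
  have hpow : ∀ m : ℕ, a ^ m ∈ patGroup P := by
    intro m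
    induction m with
    | zero => simpa using one_mem_patGroup P
    | succ m ih => rw [pow_succ]; exact mul_mem_patGroup hP1 hP2 ih ha
  obtain ⟨m, hm, h⟩ := isOfFinOrder_iff_pow_eq_one.1
    (isOfFinOrder_of_finite ((Matrix.isUnit_iff_isUnit_det a).2 hdet).unit)
  have h' : a ^ m = 1 := by simpa using congrArg Units.val h
  obtain ⟨k, rfl⟩ := Nat.exists_eq_succ_of_ne_zero hm.ne'
  rw [Matrix.inv_eq_left_inv (by rw [← pow_succ]; exact h')]
  exact hpow k

/-- The group structure on the pattern group of a strict order refining `<`. -/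
@[reducible] noncomputable def patGroupGroup {P : Fin n → Fin n → Prop}
    (hP1 : ∀ i j, P i j → i < j) (hP2 : ∀ i j k, P i j → P j k → P i k) :
    Group (PatElt F P) where
  mul a b := ⟨(a : Mat n F) * b, mul_mem_patGroup hP1 hP2 a.2 b.2⟩
  one := ⟨1, one_mem_patGroup P⟩
  inv a := ⟨(a : Mat n F)⁻¹, inv_mem_patGroup hP1 hP2 a.2⟩
  mul_assoc a b c := Subtype.ext (mul_assoc (a : Mat n F) b c)
  one_mul a := Subtype.ext (one_mul (a : Mat n F))
  mul_one a := Subtype.ext (mul_one (a : Mat n F))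
  inv_mul_cancel a := Subtype.ext (Matrix.nonsing_inv_mul (a : Mat n F)
    (by simp [det_of_mem_patGroup hP1 a.2]))

/-- The proportion of elements of the pattern group fixing `lam` on the left is the inverse of
the size of the left orbit. -/
theorem inv_ncard_dualLeftOrbit {P : Fin n → Fin n → Prop} (hP1 : ∀ i j, P i j → i < j)
    (hP2 : ∀ i j k, P i j → P j k → P i k) {lam : Mat n F}
    (hlam : ∀ i j, ¬ P i j → lam i j = 0) :
    ((dualLeftOrbit P lam).ncard : ℂ)⁻¹ =
      (∑ a : PatElt F P, if truncP P ((a : Mat n F)ᵀ * lam) = lam then 1 else 0) /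
        Fintype.card (PatElt F P) := by
  let := patGroupGroup (F := F) hP1 hP2
  set f : PatElt F P → Mat n F := fun a => truncP P (((a : Mat n F)⁻¹)ᵀ * lam)
  have hrange : dualLeftOrbit P lam = Set.range f := by
    ext mu
    simp [dualLeftOrbit, f, eq_comm]
  have hf : ∀ k g h, f g = f h → f (k * g) = f (k * h) := by
    have hmul : ∀ k g, f (k * g) = truncP P (((k : Mat n F)⁻¹)ᵀ * f g) := by
      intro k g
      rw [truncP_mul_truncP hP2 (inv_mem_patGroup hP1 hP2 k.2), ← Matrix.mul_assoc,
        ← Matrix.transpose_mul, ← Matrix.mul_inv_rev]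
      rfl
    intro k g h hgh
    rw [hmul, hmul, hgh]
  have hmem : lam ∈ Set.range f := by
    refine ⟨⟨1, one_mem_patGroup P⟩, ?_⟩
    simp [f, truncP_eq_self hlam]
  have h1 : ∑ᶠ x ∈ Set.range f, (if x = lam then (1 : ℂ) else 0) = 1 := by
    rw [finsum_mem_eq_finite_toFinset_sum _ (Set.toFinite _), Finset.sum_ite_eq', if_pos]
    exact (Set.Finite.mem_toFinset _).2 hmem
  have key := card_mul_finsum_range f hf fun x => if x = lam then (1 : ℂ) else 0
  rw [h1, mul_one] at key
  have hinv : ∑ g, (if f g = lam then (1 : ℂ) else 0) =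
      ∑ a : PatElt F P,
        if truncP P ((a : Mat n F)ᵀ * lam) = lam then (1 : ℂ) else 0 := by
    refine Fintype.sum_equiv (Equiv.inv _) _ _ fun a => ?_
    rfl
  rw [hrange, ← hinv, key]
  have hcard : (Fintype.card (PatElt F P) : ℂ) ≠ 0 := by simp
  rw [key] at hcard
  have h2 := left_ne_zero_of_mul hcard
  have h3 := right_ne_zero_of_mul hcard
  field_simp

/-- The supercharacter as an average over pairs of group elements. -/
theorem superChar_eq_expect {P : Fin n → Fin n → Prop} (hP1 : ∀ i j, P i j → i < j)
    (hP2 : ∀ i j k, P i j → P j k → P i k) (θ : AddChar F ℂ) {u : Mat n F}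
    (hu : u ∈ patGroup P) (lam : Mat n F) :
    superChar P θ lam u = (dualLeftOrbit P lam).ncard *
      ((∑ w : PatElt F P × PatElt F P,
          θ (- pairM lam ((w.1 : Mat n F) * (u - 1) * w.2))) /
        Fintype.card (PatElt F P × PatElt F P)) := by
  let := patGroupGroup (F := F) hP1 hP2
  have hx : ∀ i j, ¬ P i j → (u - 1) i j = 0 := by
    intro i j hij
    by_cases h : i = j
    · subst h; simp [hu.1]
    · simp [h, hu.2 i j h hij]
  set f : PatElt F P × PatElt F P → Mat n F :=
    fun w => truncP P (((w.1 : Mat n F)⁻¹)ᵀ * lam * (w.2 : Mat n F)ᵀ)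
  have hrange : dualOrbit P lam = Set.range f := by
    ext mu
    constructor
    · rintro ⟨a, ha, b, hb, rfl⟩
      exact ⟨(⟨a, ha⟩, ⟨b⁻¹, inv_mem_patGroup hP1 hP2 hb⟩), rfl⟩
    · rintro ⟨⟨a, b⟩, rfl⟩
      refine ⟨a, a.2, (b : Mat n F)⁻¹, inv_mem_patGroup hP1 hP2 b.2, ?_⟩
      rw [inv_inv_of_mem_patGroup hP1 b.2]
  have hf : ∀ k g h, f g = f h → f (k * g) = f (k * h) := by
    have hmul : ∀ k g, f (k * g) =
        truncP P (((k.1 : Mat n F)⁻¹)ᵀ * f g * (k.2 : Mat n F)ᵀ) := by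
      intro k g
      rw [truncP_mul_truncP_mul hP2 (inv_mem_patGroup hP1 hP2 k.1.2) k.2.2]
      have h1 : (((k * g).1 : Mat n F)⁻¹)ᵀ = ((k.1 : Mat n F)⁻¹)ᵀ * ((g.1 : Mat n F)⁻¹)ᵀ := by
        rw [← Matrix.transpose_mul, ← Matrix.mul_inv_rev]
        rfl
      have h2 : ((k * g).2 : Mat n F)ᵀ = (g.2 : Mat n F)ᵀ * (k.2 : Mat n F)ᵀ := by
        rw [← Matrix.transpose_mul]
        rfl
      simp only [f, h1, h2, Matrix.mul_assoc]
    intro k g h hgh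
    rw [hmul, hmul, hgh]
  have key := card_mul_finsum_range f hf fun mu => θ (- pairM mu (u - 1))
  have hinv : ∑ w, θ (- pairM (f w) (u - 1)) =
      ∑ w : PatElt F P × PatElt F P,
        θ (- pairM lam ((w.1 : Mat n F) * (u - 1) * w.2)) := by
    refine Fintype.sum_equiv ((Equiv.inv _).prodCongr (Equiv.refl _)) _ _ fun w => ?_
    rw [pairM_truncP hx]
    rfl
  rw [hinv] at key
  have hcard : (Fintype.card
      (PatElt F P × PatElt F P) : ℂ) ≠ 0 :=
    Nat.cast_ne_zero.2 Fintype.card_ne_zero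
  have horb : ((Set.range f).ncard : ℂ) ≠ 0 := by
    rw [Nat.cast_ne_zero, ← Nat.pos_iff_ne_zero, Set.ncard_pos]
    exact Set.range_nonempty f
  rw [superChar, hrange]
  field_simp
  linear_combination ((dualLeftOrbit P lam).ncard : ℂ) * key

end PatternGroup

section Mixing

variable {n : ℕ} {F : Type*} [Field F]

/-- The element of the pattern group with the entries of `a` at the positions satisfying `D` and
the entries of `b` elsewhere. -/
noncomputable def mixAt {P : Fin n → Fin n → Prop} (D : Fin n → Fin n → Prop)
    (a b : PatElt F P) : PatElt F P :=
  ⟨Matrix.of fun i j => if D i j then (a : Mat n F) i j else (b : Mat n F) i j,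
    fun i => by simp [a.2.1, b.2.1], fun i j hij h => by simp [a.2.2 i j hij h, b.2.2 i j hij h]⟩

theorem mixAt_apply_of_pos {P D : Fin n → Fin n → Prop} (a b : PatElt F P)
    {i j : Fin n} (h : D i j) : (mixAt D a b : Mat n F) i j = (a : Mat n F) i j := by
  simp [mixAt, h]

theorem mixAt_apply_of_neg {P D : Fin n → Fin n → Prop} (a b : PatElt F P)
    {i j : Fin n} (h : ¬ D i j) : (mixAt D a b : Mat n F) i j = (b : Mat n F) i j := by
  simp [mixAt, h]

/-- Exchanging the entries at the positions not satisfying `D`. -/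
noncomputable def swapAt {P : Fin n → Fin n → Prop} (D : Fin n → Fin n → Prop) :
    Equiv.Perm (PatElt F P × PatElt F P) :=
  Function.Involutive.toPerm (fun w => (mixAt D w.1 w.2, mixAt D w.2 w.1)) fun w => by
    refine Prod.ext ?_ ?_ <;> refine Subtype.ext (Matrix.ext fun i j => ?_) <;>
      by_cases h : D i j <;> simp [mixAt, h]

theorem truncP_transpose_mul_congr {P : Fin n → Fin n → Prop} {L a b : Mat n F}
    (h : ∀ i j, L i j ≠ 0 → ∀ k, a i k = b i k) :
    truncP P (aᵀ * L) = truncP P (bᵀ * L) := by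
  congr 1
  ext k j
  simp only [Matrix.mul_apply, Matrix.transpose_apply]
  refine Finset.sum_congr rfl fun i _ => ?_
  by_cases hL : L i j = 0
  · simp [hL]
  · rw [h i j hL k]

theorem pairM_mul_mul_congr {L x a b a' b' : Mat n F}
    (ha : ∀ i j, L i j ≠ 0 → ∀ k, a i k = a' i k) (hb : ∀ i j, L i j ≠ 0 → ∀ k, b k j = b' k j) :
    pairM L (a * x * b) = pairM L (a' * x * b') := by
  refine Finset.sum_congr rfl fun i _ => Finset.sum_congr rfl fun j _ => ?_
  by_cases hL : L i j = 0
  · simp [hL]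
  · simp only [Matrix.mul_apply, ha i j hL, hb i j hL]

theorem pairM_sum {κ : Type*} [Fintype κ] (L : κ → Mat n F) (x : Mat n F) :
    pairM (∑ k, L k) x = ∑ k, pairM (L k) x := by
  simp only [pairM_eq_trace, Matrix.transpose_sum, Matrix.sum_mul, Matrix.trace_sum]

variable {κ : Type*} [Fintype κ]

theorem addChar_map_sum (θ : AddChar F ℂ) (x : κ → F) : θ (∑ k, x k) = ∏ k, θ (x k) :=
  map_prod θ.toMonoidHom (fun k => Multiplicative.ofAdd (x k)) Finset.univ

theorem truncP_mul_sum_eq_iff {P : Fin n → Fin n → Prop} (L : κ → Mat n F)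
    (hcol : ∀ k k' i i' j, L k i j ≠ 0 → L k' i' j ≠ 0 → k = k') (a : Mat n F) :
    truncP P (aᵀ * ∑ k, L k) = ∑ k, L k ↔ ∀ k, truncP P (aᵀ * L k) = L k := by
  have hsum : truncP P (aᵀ * ∑ k, L k) = ∑ k, truncP P (aᵀ * L k) := by
    ext i j
    simp only [Matrix.mul_sum, Matrix.sum_apply, truncP, Matrix.of_apply]
    split_ifs <;> simp
  rw [hsum]
  refine ⟨fun h k => ?_, fun h => Finset.sum_congr rfl fun k _ => h k⟩
  have hzero : ∀ k j, (∀ i, L k i j = 0) → ∀ i, truncP P (aᵀ * L k) i j = 0 := by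
    intro k j hj i
    simp [truncP, Matrix.mul_apply, hj]
  ext i j
  by_cases hj : ∀ i, L k i j = 0
  · rw [hzero k j hj, hj]
  · push Not at hj
    obtain ⟨i₀, hi₀⟩ := hj
    have hother : ∀ k', k' ≠ k → ∀ i, L k' i j = 0 := by
      intro k' hk' i
      by_contra hne
      exact hk' (hcol _ _ _ _ _ hne hi₀)
    have hij := congrFun (congrFun h i) j
    rw [Matrix.sum_apply, Matrix.sum_apply,
      Finset.sum_eq_single k (fun k' _ hk' => hzero k' j (hother k' hk') i) (by simp),
      Finset.sum_eq_single k (fun k' _ hk' => hother k' hk' i) (by simp)] at hij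
    exact hij

variable [Fintype F]

theorem ncard_dualLeftOrbit_sum {P : Fin n → Fin n → Prop} (hP1 : ∀ i j, P i j → i < j)
    (hP2 : ∀ i j k, P i j → P j k → P i k) (L : κ → Mat n F)
    (hL : ∀ k i j, ¬ P i j → L k i j = 0)
    (hrow : ∀ k k' i j j', L k i j ≠ 0 → L k' i j' ≠ 0 → k = k')
    (hcol : ∀ k k' i i' j, L k i j ≠ 0 → L k' i' j ≠ 0 → k = k') :
    ((dualLeftOrbit P (∑ k, L k)).ncard : ℂ) = ∏ k, ((dualLeftOrbit P (L k)).ncard : ℂ) := by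
  apply inv_injective
  rw [← Finset.prod_inv_distrib, inv_ncard_dualLeftOrbit hP1 hP2
    (fun i j hij => by rw [Matrix.sum_apply]; exact Finset.sum_eq_zero fun k _ => hL k i j hij)]
  simp_rw [fun k => inv_ncard_dualLeftOrbit hP1 hP2 (hL k)]
  have : Nonempty (PatElt F P) := ⟨⟨1, one_mem_patGroup P⟩⟩
  rw [← expect_prod_eq_prod_expect]
  · congr 1
    refine Finset.sum_congr rfl fun a _ => ?_
    rw [Finset.prod_ite_zero]
    simp [truncP_mul_sum_eq_iff L hcol]
  · intro k
    refine ⟨swapAt fun i _ => ∃ j, L k i j ≠ 0, fun w => ⟨?_, fun k' hk' => ?_⟩⟩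
    · rw [truncP_transpose_mul_congr (b := (w.1 : Mat n F))]
      exact fun i j h m => mixAt_apply_of_pos _ _ ⟨j, h⟩
    · rw [truncP_transpose_mul_congr (b := (w.2 : Mat n F))]
      rintro i j h m
      refine mixAt_apply_of_neg _ _ ?_
      rintro ⟨j', h'⟩
      exact hk' (hrow _ _ _ _ _ h h')

/-- Supercharacters are multiplicative on sums of functionals whose supports lie in disjoint sets
of rows and disjoint sets of columns. -/
theorem superChar_sum {P : Fin n → Fin n → Prop} (hP1 : ∀ i j, P i j → i < j)
    (hP2 : ∀ i j k, P i j → P j k → P i k) (θ : AddChar F ℂ) {u : Mat n F}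
    (hu : u ∈ patGroup P) (L : κ → Mat n F) (hL : ∀ k i j, ¬ P i j → L k i j = 0)
    (hrow : ∀ k k' i j j', L k i j ≠ 0 → L k' i j' ≠ 0 → k = k')
    (hcol : ∀ k k' i i' j, L k i j ≠ 0 → L k' i' j ≠ 0 → k = k') :
    superChar P θ (∑ k, L k) u = ∏ k, superChar P θ (L k) u := by
  simp_rw [superChar_eq_expect hP1 hP2 θ hu]
  rw [Finset.prod_mul_distrib, ncard_dualLeftOrbit_sum hP1 hP2 L hL hrow hcol]
  congr 1
  have : Nonempty (PatElt F P) := ⟨⟨1, one_mem_patGroup P⟩⟩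
  rw [← expect_prod_eq_prod_expect]
  · congr 1
    refine Finset.sum_congr rfl fun w _ => ?_
    rw [pairM_sum, ← Finset.sum_neg_distrib, addChar_map_sum]
  · intro k
    refine ⟨(Equiv.prodProdProdComm _ _ _ _).trans
      (((swapAt fun i _ => ∃ j, L k i j ≠ 0).prodCongr
        (swapAt fun _ j => ∃ i, L k i j ≠ 0)).trans (Equiv.prodProdProdComm _ _ _ _)),
      fun w => ⟨?_, fun k' hk' => ?_⟩⟩
    · rw [pairM_mul_mul_congr (a' := (w.1.1 : Mat n F)) (b' := (w.1.2 : Mat n F))]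
      · exact fun i j h m => mixAt_apply_of_pos _ _ ⟨j, h⟩
      · exact fun i j h m => mixAt_apply_of_pos _ _ ⟨i, h⟩
    · rw [pairM_mul_mul_congr (a' := (w.2.1 : Mat n F)) (b' := (w.2.2 : Mat n F))]
      · rintro i j h m
        refine mixAt_apply_of_neg _ _ ?_
        rintro ⟨j', h'⟩
        exact hk' (hrow _ _ _ _ _ h h')
      · rintro i j h m
        refine mixAt_apply_of_neg _ _ ?_
        rintro ⟨i', h'⟩
        exact hk' (hcol _ _ _ _ _ h h')

end Mixing

section Components

variable {n : ℕ} {F : Type*} [Field F]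

theorem adjRel_symm {A : Mat n F} {p q : Fin n × Fin n} (h : adjRel A p q) : adjRel A q p :=
  ⟨h.1.symm, h.2.2.1, h.2.1, h.2.2.2.imp Eq.symm Eq.symm⟩

theorem compOf_eq_of_mem {A : Mat n F} {p q : Fin n × Fin n} (h : q ∈ compOf A p) :
    compOf A p = compOf A q := by
  have h' : Relation.ReflTransGen (adjRel A) q p :=
    haveI : Std.Symm (adjRel A) := ⟨fun _ _ => adjRel_symm⟩
    Std.Symm.symm _ _ h
  ext r
  exact ⟨h'.trans, Relation.ReflTransGen.trans h⟩

theorem eq_compOf_of_mem {A : Mat n F} {T : Set (Fin n × Fin n)} (hT : T ∈ comps A)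
    {p : Fin n × Fin n} (hp : p ∈ T) : T = compOf A p := by
  obtain ⟨q, -, rfl⟩ := hT
  exact compOf_eq_of_mem hp

theorem eq_of_mem_comps {A : Mat n F} {T T' : Set (Fin n × Fin n)} (hT : T ∈ comps A)
    (hT' : T' ∈ comps A) {p q : Fin n × Fin n} (hp : p ∈ T) (hq : q ∈ T') (hAp : A p.1 p.2 ≠ 0)
    (hAq : A q.1 q.2 ≠ 0) (hpq : p.1 = q.1 ∨ p.2 = q.2) : T = T' := by
  rw [eq_compOf_of_mem hT hp, eq_compOf_of_mem hT' hq]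
  by_cases h : p = q
  · rw [h]
  · exact compOf_eq_of_mem (Relation.ReflTransGen.single ⟨h, hAp, hAq, hpq⟩)

theorem restrictTo_ne_zero {A : Mat n F} {T : Set (Fin n × Fin n)} {i j : Fin n}
    (h : restrictTo T A i j ≠ 0) : (i, j) ∈ T ∧ A i j ≠ 0 := by
  simpa [restrictTo] using h

theorem sum_restrictTo_comps (A : Mat n F) [Fintype (comps A)] :
    ∑ T : comps A, restrictTo (T : Set (Fin n × Fin n)) A = A := by
  ext i j
  rw [Matrix.sum_apply]
  by_cases hA : A i j = 0
  · simp [restrictTo, hA]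
  · rw [Finset.sum_eq_single ⟨compOf A (i, j), (i, j), hA, rfl⟩]
    · have : (i, j) ∈ compOf A (i, j) := Relation.ReflTransGen.refl
      simp [restrictTo, this]
    · intro T _ hT
      by_contra h
      exact hT (Subtype.ext (eq_compOf_of_mem T.2 (restrictTo_ne_zero h).1))
    · simp

end Components

/-- With `T_1,…,T_l` the connected components of `G_λ`:
`χ^λ(u) = ∏_{i=1}^{l} χ^{λ[T_i]}(u)`. -/
theorem stmt13 {n : ℕ} {F : Type*} [Field F] [Fintype F]
    (P : Fin n → Fin n → Prop)
    (hP1 : ∀ i j : Fin n, P i j → i < j)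
    (hP2 : ∀ i j k : Fin n, P i j → P j k → P i k)
    (θ : AddChar F ℂ) (hθ : ∃ x, θ x ≠ 1)
    (u : Mat n F) (hu : u ∈ patGroup P)
    (lam : Mat n F) (hlam : ∀ i j : Fin n, ¬ P i j → lam i j = 0) :
    superChar P θ lam u = ∏ᶠ T ∈ comps lam, superChar P θ (restrictTo T lam) u := by
  calc superChar P θ lam u
      = superChar P θ (∑ T : comps lam, restrictTo (T : Set (Fin n × Fin n)) lam) u := by
        rw [sum_restrictTo_comps]
    _ = ∏ T : comps lam, superChar P θ (restrictTo (T : Set (Fin n × Fin n)) lam) u := by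
        refine superChar_sum hP1 hP2 θ hu _ (fun T i j hij => ?_) (fun T T' i j j' h h' => ?_)
          fun T T' i i' j h h' => ?_
        · simp [restrictTo, hlam i j hij]
        · obtain ⟨hm, hne⟩ := restrictTo_ne_zero h
          obtain ⟨hm', hne'⟩ := restrictTo_ne_zero h'
          exact Subtype.ext (eq_of_mem_comps T.2 T'.2 hm hm' hne hne' (Or.inl rfl))
        · obtain ⟨hm, hne⟩ := restrictTo_ne_zero h
          obtain ⟨hm', hne'⟩ := restrictTo_ne_zero h'
          exact Subtype.ext (eq_of_mem_comps T.2 T'.2 hm hm' hne hne' (Or.inr rfl))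
    _ = ∏ᶠ T ∈ comps lam, superChar P θ (restrictTo T lam) u := by
        rw [← finprod_set_coe_eq_finprod_mem, finprod_eq_prod_of_fintype]
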